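/- Let p < q be odd primes and let h be a minimal vanishing sorou whose relative order divides 2pq. Then one of the following holds: (a) h = {z, −z} for some root of unity z; (b) h is a rotation of {1, ν_p, …, ν_p^{p−1}}; (c) h is a rotation of {1, ν_q, …, ν_q^{q−1}}; or (d) there exist a proper nonempty subset I of {0, 1, …, p−1} with 0 ∈ I and |I| ≤ (p−1)/2, a proper nonempty subset J of {0, 1, …, q−1}, and a root of unity z, such that z·h equals the multiset consisting of the elements ν_p^i ν_q^j for i ∈ I and j ∉ J, together with the elements −ν_p^i ν_q^j for i ∉ I and j ∈ J. -/

import Mathlib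

open Complex

noncomputable def nu (n : ℕ) : ℂ := Complex.exp (2 * Real.pi * Complex.I / n)

def IsRootOfUnity (z : ℂ) : Prop := ∃ n : ℕ, 0 < n ∧ z ^ n = 1

def IsSorou (h : Multiset ℂ) : Prop := h ≠ 0 ∧ ∀ z ∈ h, IsRootOfUnity z

noncomputable def rootOrder (z : ℂ) : ℕ := sInf {d : ℕ | 0 < d ∧ z ^ d = 1}

noncomputable def sorouOrder (h : Multiset ℂ) : ℕ := (h.map rootOrder).lcm

noncomputable def relOrder (h : Multiset ℂ) : ℕ :=
  (h.bind fun a => h.map fun b => rootOrder (a / b)).lcm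

def IsMinVanishing (h : Multiset ℂ) : Prop :=
  h.sum = 0 ∧ ∀ g : Multiset ℂ, g ≤ h → g ≠ 0 → g ≠ h → g.sum ≠ 0

theorem stdAddChar_eq_nu_pow (n : ℕ) [NeZero n] (i : ZMod n) :
    ZMod.stdAddChar i = nu n ^ i.val := by
  conv_lhs => rw [← ZMod.natCast_zmod_val i]
  have := ZMod.stdAddChar_coe (N := n) (i.val : ℤ)
  push_cast at this
  rw [this, nu, ← Complex.exp_nat_mul]
  congr 1
  ring

theorem isPrimitiveRoot_nu (n : ℕ) [NeZero n] : IsPrimitiveRoot (nu n) n :=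
  Complex.isPrimitiveRoot_exp n (NeZero.ne n)

theorem nu_pow_eq_stdAddChar (n : ℕ) [NeZero n] (k : ℕ) :
    nu n ^ k = ZMod.stdAddChar (k : ZMod n) := by
  rw [stdAddChar_eq_nu_pow, ZMod.val_natCast]
  exact pow_eq_pow_mod k (isPrimitiveRoot_nu n).pow_eq_one

theorem nu_mul_pow_left (m n : ℕ) [NeZero m] [NeZero n] : nu (m * n) ^ n = nu m := by
  have hm : (m : ℂ) ≠ 0 := NeZero.ne _
  have hn : (n : ℂ) ≠ 0 := NeZero.ne _
  rw [nu, nu, ← Complex.exp_nat_mul]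
  congr 1
  push_cast
  field_simp

open scoped ZMod in
theorem eq_of_dft_eq_zero {n : ℕ} [NeZero n] (c : ZMod n → ℂ)
    (hc : ∀ t : ZMod n, t ≠ 0 → ∑ j, c j * ZMod.stdAddChar (t * j) = 0) (j j' : ZMod n) :
    c j = c j' := by
  have key : ∀ k, c k = (n : ℂ)⁻¹ • 𝓕 c 0 := fun k => by
    conv_lhs => rw [← ZMod.dft.symm_apply_apply c]
    rw [ZMod.invDFT_apply]
    congr 1
    rw [Finset.sum_eq_single 0]
    · simp
    · intro t _ ht
      rw [ZMod.dft_apply, smul_eq_mul]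
      convert mul_zero _
      rw [← hc (-t) (neg_ne_zero.mpr ht)]
      refine Finset.sum_congr rfl fun i _ => ?_
      rw [smul_eq_mul, mul_comm, neg_mul, mul_comm t]
    · simp
  rw [key, key j']

theorem sum_conj_eq_zero {p q : ℕ} [Fact p.Prime] [Fact q.Prime] (hpq : p ≠ q)
    (a : ZMod p → ZMod q → ℤ)
    (h0 : ∑ i, ∑ j, (a i j : ℂ) * (ZMod.stdAddChar i * ZMod.stdAddChar j) = 0)
    (s : ZMod p) (t : ZMod q) (hs : s ≠ 0) (ht : t ≠ 0) :
    ∑ i, ∑ j, (a i j : ℂ) * (ZMod.stdAddChar (s * i) * ZMod.stdAddChar (t * j)) = 0 := by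
  have hcop : Nat.Coprime p q := (Nat.coprime_primes Fact.out Fact.out).mpr hpq
  have hz := isPrimitiveRoot_nu (p * q)
  obtain ⟨k, hkp, hkq⟩ := Nat.chineseRemainder hcop s.val t.val
  have hkp' : (k : ZMod p) = s := by
    rw [(ZMod.natCast_eq_natCast_iff _ _ _).mpr hkp, ZMod.natCast_zmod_val]
  have hkq' : (k : ZMod q) = t := by
    rw [(ZMod.natCast_eq_natCast_iff _ _ _).mpr hkq, ZMod.natCast_zmod_val]
  have hk : k.Coprime (p * q) := by
    refine Nat.Coprime.mul_right ?_ ?_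
    · rw [Nat.coprime_comm, Nat.Prime.coprime_iff_not_dvd Fact.out, ← ZMod.natCast_eq_zero_iff,
        hkp']
      exact hs
    · rw [Nat.coprime_comm, Nat.Prime.coprime_iff_not_dvd Fact.out, ← ZMod.natCast_eq_zero_iff,
        hkq']
      exact ht
  let F : Polynomial ℤ := ∑ i : ZMod p, ∑ j : ZMod q,
    Polynomial.C (a i j) * Polynomial.X ^ (q * i.val + p * j.val)
  have hF : ∀ m : ℕ, Polynomial.aeval (nu (p * q) ^ m) F = ∑ i : ZMod p, ∑ j : ZMod q,
      (a i j : ℂ) * (ZMod.stdAddChar ((m : ZMod p) * i) * ZMod.stdAddChar ((m : ZMod q) * j)) := by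
    intro m
    simp only [F, map_sum, map_mul, map_pow, Polynomial.aeval_X, Polynomial.aeval_C]
    refine Finset.sum_congr rfl fun i _ => Finset.sum_congr rfl fun j _ => ?_
    have e1 : nu (p * q) ^ p = nu q := by rw [mul_comm, nu_mul_pow_left]
    congr 1
    rw [pow_add, ← pow_mul, ← pow_mul]
    rw [show m * (q * i.val) = q * (m * i.val) by ring,
      show m * (p * j.val) = p * (m * j.val) by ring, pow_mul, pow_mul _ p, nu_mul_pow_left, e1,
      nu_pow_eq_stdAddChar, nu_pow_eq_stdAddChar]
    simp
  have h1 : Polynomial.aeval (nu (p * q)) F = 0 := by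
    have := hF 1
    simp only [pow_one, Nat.cast_one, one_mul] at this
    rw [this, h0]
  have hd := minpoly.isIntegrallyClosed_dvd (hz.isIntegral (NeZero.pos _)) h1
  rw [hz.minpoly_eq_pow_coprime hk] at hd
  have h2 : Polynomial.aeval (nu (p * q) ^ k) F = 0 :=
    (Polynomial.aeval_eq_zero_of_dvd_aeval_eq_zero hd (minpoly.aeval _ _))
  rw [hF, hkp', hkq'] at h2
  exact h2

theorem exists_add_of_sum_eq_zero {p q : ℕ} [Fact p.Prime] [Fact q.Prime] (hpq : p ≠ q)
    (a : ZMod p → ZMod q → ℤ)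
    (h0 : ∑ i, ∑ j, (a i j : ℂ) * (ZMod.stdAddChar i * ZMod.stdAddChar j) = 0) :
    ∃ (x : ZMod p → ℤ) (y : ZMod q → ℤ), ∀ i j, a i j = x i + y j := by
  have h1 : ∀ s : ZMod p, s ≠ 0 → ∀ j j', ∑ i, (a i j : ℂ) * ZMod.stdAddChar (s * i) =
      ∑ i, (a i j' : ℂ) * ZMod.stdAddChar (s * i) := by
    intro s hs
    refine eq_of_dft_eq_zero (fun j => ∑ i, (a i j : ℂ) * ZMod.stdAddChar (s * i)) ?_
    intro t ht
    rw [← sum_conj_eq_zero hpq a h0 s t hs ht, Finset.sum_comm]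
    refine Finset.sum_congr rfl fun i _ => ?_
    rw [Finset.sum_mul]
    exact Finset.sum_congr rfl fun j _ => by ring
  have h2 : ∀ j i i', (a i j : ℂ) - a i 0 = a i' j - a i' 0 := by
    intro j
    refine eq_of_dft_eq_zero (fun i => (a i j : ℂ) - a i 0) fun s hs => ?_
    simp only [sub_mul, Finset.sum_sub_distrib]
    rw [h1 s hs j 0, sub_self]
  refine ⟨fun i => a i 0, fun j => a 0 j - a 0 0, fun i j => ?_⟩
  have := h2 j i 0
  have h3 : a i j - a i 0 = a 0 j - a 0 0 := by exact_mod_cast this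
  linarith

/-- Additive matrix with no row or column of constant strict sign contains a sign pattern
given by a set of rows and a set of columns. -/
theorem exists_sign_pattern {α β : Type*} [Fintype α] [Fintype β] [DecidableEq α] [DecidableEq β]
    [Nonempty α] [Nonempty β] (x : α → ℤ) (y : β → ℤ)
    (hc1 : ∀ j, ∃ i, x i + y j ≤ 0) (hc2 : ∀ j, ∃ i, 0 ≤ x i + y j)
    (hr1 : ∀ i, ∃ j, x i + y j ≤ 0) (hr2 : ∀ i, ∃ j, 0 ≤ x i + y j)
    (hne : ∃ i j, x i + y j ≠ 0) :
    ∃ (I : Finset α) (J : Finset β), I.Nonempty ∧ I ≠ Finset.univ ∧ J.Nonempty ∧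
      J ≠ Finset.univ ∧ (∀ i ∈ I, ∀ j ∉ J, 0 < x i + y j) ∧
      ∀ i ∉ I, ∀ j ∈ J, x i + y j < 0 := by
  obtain ⟨i1, h1⟩ := Finite.exists_max x
  obtain ⟨i0, h0⟩ := Finite.exists_min x
  obtain ⟨j1, k1⟩ := Finite.exists_max y
  obtain ⟨j0, k0⟩ := Finite.exists_min y
  obtain ⟨a, ha⟩ := hc2 j0
  obtain ⟨b, hb⟩ := hr1 i1
  obtain ⟨c, hc⟩ := hc1 j1
  obtain ⟨d, hd⟩ := hr2 i0
  obtain ⟨e, f, hef⟩ := hne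
  have := h1 a
  have := k0 b
  have := h0 c
  have := k1 d
  refine ⟨Finset.univ.filter fun i => x i = x i1, Finset.univ.filter fun j => y j = y j0,
    ⟨i1, by simp⟩, ?_, ⟨j0, by simp⟩, ?_, ?_, ?_⟩
  · intro hu
    have h2 : ∀ i, x i = x i1 := by simpa [Finset.ext_iff] using hu
    have := h2 i0
    have := h2 e
    have := k1 f
    have := k0 f
    apply hef
    linarith
  · intro hu
    have h2 : ∀ j, y j = y j0 := by simpa [Finset.ext_iff] using hu
    have := h2 j1
    have := h2 f
    have := h0 e
    have := h1 e
    apply hef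
    linarith
  · intro i hi j hj
    simp only [Finset.mem_filter, Finset.mem_univ, true_and] at hi hj
    have := lt_of_le_of_ne (k0 j) (Ne.symm hj)
    linarith
  · intro i hi j hj
    simp only [Finset.mem_filter, Finset.mem_univ, true_and] at hi hj
    have := lt_of_le_of_ne (h1 i) hi
    linarith

/-- The index type of the `2pq`-th roots of unity: the left summand indexes the roots of order
dividing `pq`, the right summand their negatives. -/
abbrev RootIndex (p q : ℕ) : Type := (ZMod q × ZMod p) ⊕ (ZMod q × ZMod p)

/-- The root of unity with a given index. -/
noncomputable def indexedRoot (p q : ℕ) [NeZero p] [NeZero q] : RootIndex p q → ℂ :=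
  Sum.elim (fun x => ZMod.stdAddChar x.2 * ZMod.stdAddChar x.1)
    (fun x => -(ZMod.stdAddChar x.2 * ZMod.stdAddChar x.1))

theorem exists_indexedRoot_eq {p q : ℕ} [Fact p.Prime] [Fact q.Prime] (hpq : p ≠ q)
    (hp : Odd p) (hq : Odd q) {w : ℂ} (hw : w ^ (2 * p * q) = 1) :
    ∃ t, indexedRoot p q t = w := by
  have hcop : Nat.Coprime q p := (Nat.coprime_primes Fact.out Fact.out).mpr hpq.symm
  have key : ∀ v : ℂ, v ^ (p * q) = 1 →
      ∃ (i : ZMod p) (j : ZMod q), ZMod.stdAddChar i * ZMod.stdAddChar j = v := by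
    intro v hv
    have hv' : (v ^ q) ^ p = 1 := by rw [← pow_mul, mul_comm, hv]
    have hv'' : (v ^ p) ^ q = 1 := by rw [← pow_mul, hv]
    obtain ⟨i, -, hi⟩ := (isPrimitiveRoot_nu p).eq_pow_of_pow_eq_one hv'
    obtain ⟨j, -, hj⟩ := (isPrimitiveRoot_nu q).eq_pow_of_pow_eq_one hv''
    rw [nu_pow_eq_stdAddChar] at hi hj
    obtain ⟨k, hk1, hk2⟩ := Nat.chineseRemainder hcop.symm 0 1
    obtain ⟨l, hl1, hl2⟩ := Nat.chineseRemainder hcop.symm 1 0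
    obtain ⟨k', rfl⟩ := (Nat.modEq_zero_iff_dvd).mp hk1
    obtain ⟨l', rfl⟩ := (Nat.modEq_zero_iff_dvd).mp hl2
    refine ⟨l' • (i : ZMod p), k' • (j : ZMod q), ?_⟩
    rw [AddChar.map_nsmul_eq_pow, AddChar.map_nsmul_eq_pow, hi, hj, ← pow_mul, ← pow_mul,
      ← pow_add]
    have hmod : q * l' + p * k' ≡ 1 [MOD p * q] := by
      rw [← Nat.modEq_and_modEq_iff_modEq_mul hcop.symm]
      exact ⟨by simpa using hl1.add hk1, by simpa using hl2.add hk2⟩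
    rw [pow_eq_pow_mod _ hv, hmod, ← pow_eq_pow_mod _ hv, pow_one]
  have h2 : (w ^ (p * q)) ^ 2 = 1 := by rw [← pow_mul, ← hw]; congr 1; ring
  rcases eq_or_eq_neg_of_sq_eq_sq _ 1 (h2.trans (one_pow 2).symm) with h | h
  · obtain ⟨i, j, hij⟩ := key w h
    exact ⟨.inl (j, i), hij⟩
  · obtain ⟨i, j, hij⟩ := key (-w) (by rw [(hp.mul hq).neg_pow, h, neg_neg])
    exact ⟨.inr (j, i), by simp [indexedRoot, hij]⟩

theorem sum_indexedRoot {p q : ℕ} [NeZero p] [NeZero q] (H : Multiset (RootIndex p q)) :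
    (H.map (indexedRoot p q)).sum = ∑ i : ZMod p, ∑ j : ZMod q,
      (((H.count (.inl (j, i)) : ℤ) - (H.count (.inr (j, i)) : ℤ) : ℤ) : ℂ) *
        (ZMod.stdAddChar i * ZMod.stdAddChar j) := by
  classical
  rw [Finset.sum_multiset_map_count, Finset.sum_subset (Finset.subset_univ _)
    (by intro t _ ht; rw [Multiset.mem_toFinset] at ht; simp [Multiset.count_eq_zero.mpr ht]),
    Fintype.sum_sum_type, ← Finset.sum_add_distrib, Fintype.sum_prod_type, Finset.sum_comm]
  refine Finset.sum_congr rfl fun i _ => Finset.sum_congr rfl fun j _ => ?_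
  simp only [indexedRoot, Sum.elim_inl, Sum.elim_inr, nsmul_eq_mul]
  push_cast
  ring

theorem sum_stdAddChar_eq_zero {n : ℕ} [Fact n.Prime] :
    ∑ i : ZMod n, (ZMod.stdAddChar i : ℂ) = 0 := by
  refine AddChar.sum_eq_zero_of_ne_one fun h => ?_
  have h1 : (ZMod.stdAddChar (1 : ZMod n) : ℂ) = ZMod.stdAddChar (0 : ZMod n) := by simp [h]
  exact one_ne_zero (ZMod.injective_stdAddChar h1)

/-- The pattern of roots of unity attached to a set of rows and a set of columns. -/
noncomputable def signPattern {p q : ℕ} [NeZero p] [NeZero q] (I : Finset (ZMod p))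
    (J : Finset (ZMod q)) : Finset (RootIndex p q) :=
  (Jᶜ ×ˢ I).disjSum (J ×ˢ Iᶜ)

theorem sum_signPattern {p q : ℕ} [Fact p.Prime] [Fact q.Prime] (I : Finset (ZMod p))
    (J : Finset (ZMod q)) : ∑ t ∈ signPattern I J, indexedRoot p q t = 0 := by
  have hI := Finset.sum_add_sum_compl I fun i : ZMod p => (ZMod.stdAddChar i : ℂ)
  have hJ := Finset.sum_add_sum_compl J fun i : ZMod q => (ZMod.stdAddChar i : ℂ)
  rw [sum_stdAddChar_eq_zero] at hI hJ
  rw [signPattern, Finset.sum_disjSum, Finset.sum_product, Finset.sum_product]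
  simp only [indexedRoot, Sum.elim_inl, Sum.elim_inr, Finset.sum_neg_distrib, ← Finset.sum_mul,
    ← Finset.mul_sum]
  rw [eq_neg_of_add_eq_zero_right hI, eq_neg_of_add_eq_zero_right hJ]
  ring

theorem indexed_classification {p q : ℕ} [Fact p.Prime] [Fact q.Prime] (hpq : p ≠ q)
    (H : Multiset (RootIndex p q)) (hH : H ≠ 0) (hsum : (H.map (indexedRoot p q)).sum = 0)
    (hmin : ∀ S : Finset (RootIndex p q), S.Nonempty → (∀ t ∈ S, t ∈ H) →
      ∑ t ∈ S, indexedRoot p q t = 0 → H = S.val) :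
    (∃ x, H = {.inl x, .inr x}) ∨
    (∃ j, H = (Finset.univ : Finset (ZMod p)).val.map fun i => .inl (j, i)) ∨
    (∃ j, H = (Finset.univ : Finset (ZMod p)).val.map fun i => .inr (j, i)) ∨
    (∃ i, H = (Finset.univ : Finset (ZMod q)).val.map fun j => .inl (j, i)) ∨
    (∃ i, H = (Finset.univ : Finset (ZMod q)).val.map fun j => .inr (j, i)) ∨
    ∃ (I : Finset (ZMod p)) (J : Finset (ZMod q)), I.Nonempty ∧ I ≠ Finset.univ ∧ J.Nonempty ∧
      J ≠ Finset.univ ∧ H = (signPattern I J).val := by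
  classical
  obtain ⟨x, y, hxy⟩ := exists_add_of_sum_eq_zero hpq
    (fun i j => (H.count (.inl (j, i)) : ℤ) - (H.count (.inr (j, i)) : ℤ))
    (by rw [← sum_indexedRoot, hsum])
  have hpos : ∀ i j, 0 < x i + y j → .inl (j, i) ∈ H := fun i j h => by
    rw [← Multiset.count_pos]; have := hxy i j; omega
  have hneg : ∀ i j, x i + y j < 0 → .inr (j, i) ∈ H := fun i j h => by
    rw [← Multiset.count_pos]; have := hxy i j; omega
  have hline : ∀ (n : ℕ) [NeZero n] (e : ZMod n → RootIndex p q), e.Injective →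
      (∀ i, e i ∈ H) → ∑ i, indexedRoot p q (e i) = 0 → H = Finset.univ.val.map e := by
    intro n _ e hinj he h0
    rw [hmin (Finset.univ.map ⟨e, hinj⟩) (by simp) (by simpa using he) (by simpa using h0),
      Finset.map_val]
    rfl
  by_cases hne : ∃ i j, x i + y j ≠ 0
  swap
  · left
    push Not at hne
    obtain ⟨t, ht⟩ := Multiset.exists_mem_of_ne_zero hH
    have : ∃ z : ZMod q × ZMod p, .inl z ∈ H ∧ .inr z ∈ H := by
      have hcount : ∀ z : ZMod q × ZMod p, H.count (.inl z) = H.count (.inr z) := fun z => by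
        have := hxy z.2 z.1
        have := hne z.2 z.1
        simp only [Prod.mk.eta] at *
        omega
      rcases t with z | z
      · exact ⟨z, ht, by rwa [← Multiset.count_pos, ← hcount, Multiset.count_pos]⟩
      · exact ⟨z, by rwa [← Multiset.count_pos, hcount, Multiset.count_pos], ht⟩
    obtain ⟨z, hz1, hz2⟩ := this
    refine ⟨z, ?_⟩
    rw [hmin {.inl z, .inr z} (by simp) (by simp [hz1, hz2])
      (by rw [Finset.sum_pair (by simp)]; simp [indexedRoot])]
    rfl
  right
  by_cases hc1 : ∀ j, ∃ i, x i + y j ≤ 0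
  swap
  · left
    push Not at hc1
    obtain ⟨j, hj⟩ := hc1
    refine ⟨j, hline p (fun i => .inl (j, i))
      (fun a b h => by simpa using h) (fun i => hpos i j (hj i)) ?_⟩
    simp [indexedRoot, ← Finset.sum_mul, sum_stdAddChar_eq_zero]
  right
  by_cases hc2 : ∀ j, ∃ i, 0 ≤ x i + y j
  swap
  · left
    push Not at hc2
    obtain ⟨j, hj⟩ := hc2
    refine ⟨j, hline p (fun i => .inr (j, i))
      (fun a b h => by simpa using h) (fun i => hneg i j (hj i)) ?_⟩
    simp [indexedRoot, ← Finset.sum_mul, sum_stdAddChar_eq_zero]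
  right
  by_cases hr1 : ∀ i, ∃ j, x i + y j ≤ 0
  swap
  · left
    push Not at hr1
    obtain ⟨i, hi⟩ := hr1
    refine ⟨i, hline q (fun j => .inl (j, i))
      (fun a b h => by simpa using h) (fun j => hpos i j (hi j)) ?_⟩
    simp [indexedRoot, ← Finset.mul_sum, sum_stdAddChar_eq_zero]
  right
  by_cases hr2 : ∀ i, ∃ j, 0 ≤ x i + y j
  swap
  · left
    push Not at hr2
    obtain ⟨i, hi⟩ := hr2
    refine ⟨i, hline q (fun j => .inr (j, i))
      (fun a b h => by simpa using h) (fun j => hneg i j (hi j)) ?_⟩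
    simp [indexedRoot, ← Finset.mul_sum, sum_stdAddChar_eq_zero]
  right
  obtain ⟨I, J, hI, hI', hJ, hJ', hp, hn⟩ := exists_sign_pattern x y hc1 hc2 hr1 hr2 hne
  refine ⟨I, J, hI, hI', hJ, hJ', hmin _ ?_ ?_ (sum_signPattern I J)⟩
  · obtain ⟨i, hi⟩ := hI
    obtain ⟨j, hj⟩ : ∃ j, j ∉ J := by
      by_contra! hc
      exact hJ' (Finset.eq_univ_iff_forall.mpr hc)
    exact ⟨.inl (j, i), by simp [signPattern, hi, hj]⟩
  · rintro (⟨j, i⟩ | ⟨j, i⟩) ht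
    · simp only [signPattern, Finset.inl_mem_disjSum, Finset.mem_product, Finset.mem_compl] at ht
      exact hpos i j (hp i ht.2 j ht.1)
    · simp only [signPattern, Finset.inr_mem_disjSum, Finset.mem_product, Finset.mem_compl] at ht
      exact hneg i j (hn i ht.2 j ht.1)

theorem IsRootOfUnity.mul {a b : ℂ} (ha : IsRootOfUnity a) (hb : IsRootOfUnity b) :
    IsRootOfUnity (a * b) := by
  obtain ⟨m, hm, hm'⟩ := ha
  obtain ⟨n, hn, hn'⟩ := hb
  exact ⟨m * n, Nat.mul_pos hm hn, by rw [mul_pow, pow_mul, hm', pow_mul', hn']; simp⟩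

theorem IsRootOfUnity.neg {a : ℂ} (ha : IsRootOfUnity a) : IsRootOfUnity (-a) := by
  rw [← neg_one_mul]
  exact IsRootOfUnity.mul ⟨2, two_pos, by norm_num⟩ ha

theorem IsRootOfUnity.inv {a : ℂ} (ha : IsRootOfUnity a) : IsRootOfUnity a⁻¹ := by
  obtain ⟨m, hm, hm'⟩ := ha
  exact ⟨m, hm, by rw [inv_pow, hm', inv_one]⟩

theorem IsRootOfUnity.ne_zero {a : ℂ} (ha : IsRootOfUnity a) : a ≠ 0 := by
  rintro rfl
  obtain ⟨m, hm, hm'⟩ := ha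
  rw [zero_pow hm.ne'] at hm'
  exact zero_ne_one hm'

theorem isRootOfUnity_stdAddChar {n : ℕ} [NeZero n] (i : ZMod n) :
    IsRootOfUnity (ZMod.stdAddChar i) :=
  ⟨n, NeZero.pos n, by
    rw [stdAddChar_eq_nu_pow, ← pow_mul, mul_comm, pow_mul, (isPrimitiveRoot_nu n).pow_eq_one,
      one_pow]⟩

theorem IsRootOfUnity.pow_eq_one_of_rootOrder_dvd {a : ℂ} (ha : IsRootOfUnity a) {n : ℕ}
    (h : rootOrder a ∣ n) : a ^ n = 1 := by
  obtain ⟨k, rfl⟩ := h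
  have : rootOrder a ∈ {d : ℕ | 0 < d ∧ a ^ d = 1} := Nat.sInf_mem ha
  rw [pow_mul, this.2, one_pow]

theorem div_pow_eq_one_of_relOrder_dvd {h : Multiset ℂ} (hs : IsSorou h) {n : ℕ}
    (hn : relOrder h ∣ n) {a b : ℂ} (ha : a ∈ h) (hb : b ∈ h) : (a / b) ^ n = 1 := by
  refine IsRootOfUnity.pow_eq_one_of_rootOrder_dvd ?_ (dvd_trans (Multiset.dvd_lcm ?_) hn)
  · rw [div_eq_mul_inv]
    exact (hs.2 a ha).mul (hs.2 b hb).inv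
  · exact Multiset.mem_bind.mpr ⟨a, ha, Multiset.mem_map_of_mem _ hb⟩

theorem map_val_univ_zmod (n : ℕ) [NeZero n] :
    (Finset.univ : Finset (ZMod n)).val.map ZMod.val = Multiset.range n := by
  rw [← Finset.image_val_of_injOn (ZMod.val_injective n).injOn, ← Finset.range_val]
  congr 1
  ext k
  simp only [Finset.mem_image, Finset.mem_univ, true_and, Finset.mem_range]
  exact ⟨fun ⟨a, h⟩ => h ▸ ZMod.val_lt a, fun h => ⟨k, ZMod.val_cast_of_lt h⟩⟩

theorem range_sdiff_image_val (n : ℕ) [NeZero n] (I : Finset (ZMod n)) :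
    Finset.range n \ I.image ZMod.val = Iᶜ.image ZMod.val := by
  have hu : Finset.range n = (Finset.univ : Finset (ZMod n)).image ZMod.val := by
    rw [← Finset.val_inj, Finset.image_val_of_injOn (ZMod.val_injective n).injOn,
      map_val_univ_zmod, Finset.range_val]
  rw [hu, ← Finset.image_sdiff _ _ (ZMod.val_injective n), Finset.compl_eq_univ_sdiff]

theorem image_val_ne_range {n : ℕ} [NeZero n] {I : Finset (ZMod n)} (hI : I ≠ Finset.univ) :
    I.image ZMod.val ≠ Finset.range n := by
  intro h
  have := range_sdiff_image_val n I
  rw [h, sdiff_self, eq_comm, Finset.bot_eq_empty, Finset.image_eq_empty,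
    Finset.compl_eq_empty_iff] at this
  exact hI this

theorem image_val_subset_range {n : ℕ} [NeZero n] (I : Finset (ZMod n)) :
    I.image ZMod.val ⊆ Finset.range n := by
  intro k hk
  obtain ⟨a, -, rfl⟩ := Finset.mem_image.mp hk
  exact Finset.mem_range.mpr (ZMod.val_lt a)

theorem map_signPattern {p q : ℕ} [NeZero p] [NeZero q] (I : Finset (ZMod p))
    (J : Finset (ZMod q)) :
    (signPattern I J).val.map (indexedRoot p q) =
      ((Finset.range q \ J.image ZMod.val).val.bind fun j =>
        (I.image ZMod.val).val.map fun i => nu p ^ i * nu q ^ j) +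
      ((J.image ZMod.val).val.bind fun j =>
        (Finset.range p \ I.image ZMod.val).val.map fun i => -(nu p ^ i * nu q ^ j)) := by
  have hv : ∀ (n : ℕ) [NeZero n] (K : Finset (ZMod n)),
      (K.image ZMod.val).val = K.val.map ZMod.val := fun n _ K =>
    Finset.image_val_of_injOn (ZMod.val_injective n).injOn
  have hprod : ∀ (A : Finset (ZMod q)) (B : Finset (ZMod p)),
      (A ×ˢ B).val = A.val.bind fun j => B.val.map fun i => (j, i) := fun A B => rfl
  rw [range_sdiff_image_val, range_sdiff_image_val, hv, hv, hv, hv, signPattern,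
    Finset.val_disjSum, Multiset.disjSum, Multiset.map_add, hprod, hprod]
  simp only [Multiset.bind_map, Multiset.map_bind, Multiset.map_map, Function.comp_def,
    indexedRoot, Sum.elim_inl, Sum.elim_inr, stdAddChar_eq_nu_pow]

theorem map_neg_signPattern {p q : ℕ} [NeZero p] [NeZero q] (I : Finset (ZMod p))
    (J : Finset (ZMod q)) :
    (signPattern I J).val.map (fun t => -indexedRoot p q t) =
      (signPattern Iᶜ Jᶜ).val.map (indexedRoot p q) := by
  simp only [signPattern, Finset.val_disjSum, Multiset.disjSum, Multiset.map_add,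
    Multiset.map_map, Function.comp_def, indexedRoot, Sum.elim_inl, Sum.elim_inr, compl_compl,
    neg_neg]
  exact add_comm _ _

theorem map_rotate_signPattern {p q : ℕ} [NeZero p] [NeZero q] (I : Finset (ZMod p))
    (J : Finset (ZMod q)) (c : ZMod p) :
    (signPattern I J).val.map (fun t => ZMod.stdAddChar c * indexedRoot p q t) =
      (signPattern (I.map (Equiv.addLeft c).toEmbedding) J).val.map (indexedRoot p q) := by
  have hc : (I.map (Equiv.addLeft c).toEmbedding)ᶜ = Iᶜ.map (Equiv.addLeft c).toEmbedding := by
    ext; simp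
  have hprod : ∀ (A : Finset (ZMod q)) (B : Finset (ZMod p)),
      (A ×ˢ B).val = A.val.bind fun j => B.val.map fun i => (j, i) := fun A B => rfl
  simp only [signPattern, hc, Finset.val_disjSum, Multiset.disjSum, Multiset.map_add,
    Multiset.map_map, Function.comp_def, indexedRoot, Sum.elim_inl, Sum.elim_inr, hprod,
    Multiset.map_bind, Finset.map_val, Equiv.coe_toEmbedding, Equiv.coe_addLeft,
    AddChar.map_add_eq_mul, mul_neg, mul_assoc]

/-- A sign pattern may be rotated so that it has at most half of the rows, one of them `0`. -/
theorem exists_normalized_signPattern {p q : ℕ} [NeZero p] [NeZero q] (hp : Odd p)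
    {I : Finset (ZMod p)} {J : Finset (ZMod q)} (hI : I.Nonempty) (hI' : I ≠ Finset.univ)
    (hJ : J.Nonempty) (hJ' : J ≠ Finset.univ) :
    ∃ (z : ℂ) (I' : Finset (ZMod p)) (J' : Finset (ZMod q)), IsRootOfUnity z ∧ 0 ∈ I' ∧
      I' ≠ Finset.univ ∧ I'.card ≤ (p - 1) / 2 ∧ J'.Nonempty ∧ J' ≠ Finset.univ ∧
      (signPattern I J).val.map (fun t => z * indexedRoot p q t) =
        (signPattern I' J').val.map (indexedRoot p q) := by
  wlog hcard : I.card ≤ (p - 1) / 2 generalizing I J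
  · obtain ⟨z, I', J', hz, h0, h1, h2, h3, h4, h5⟩ := this (I := Iᶜ) (J := Jᶜ)
      (by rwa [Finset.nonempty_iff_ne_empty, Ne, Finset.compl_eq_empty_iff])
      (by rw [Ne, Finset.compl_eq_univ_iff]; exact hI.ne_empty)
      (by rwa [Finset.nonempty_iff_ne_empty, Ne, Finset.compl_eq_empty_iff])
      (by rw [Ne, Finset.compl_eq_univ_iff]; exact hJ.ne_empty)
      (by rw [Finset.card_compl, ZMod.card]; obtain ⟨k, rfl⟩ := hp; omega)
    refine ⟨-z, I', J', hz.neg, h0, h1, h2, h3, h4, ?_⟩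
    rw [← h5]
    have := congrArg (Multiset.map fun w => z * w) (map_neg_signPattern I J)
    simpa only [Multiset.map_map, Function.comp_def, mul_neg, neg_mul] using this
  obtain ⟨i, hi⟩ := hI
  refine ⟨ZMod.stdAddChar (-i), I.map (Equiv.addLeft (-i)).toEmbedding, J,
    isRootOfUnity_stdAddChar _, by simpa using hi, ?_, by simpa using hcard, hJ, hJ',
    map_rotate_signPattern I J _⟩
  intro h
  apply hI'
  rw [← Finset.card_eq_iff_eq_univ] at h ⊢
  simpa using h

theorem exists_indexed_of_relOrder_dvd {p q : ℕ} [Fact p.Prime] [Fact q.Prime] (hpq : p ≠ q)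
    (hp : Odd p) (hq : Odd q) {h : Multiset ℂ} (hs : IsSorou h)
    (hdvd : relOrder h ∣ 2 * p * q) :
    ∃ (w : ℂ) (H : Multiset (RootIndex p q)), IsRootOfUnity w ∧ H ≠ 0 ∧
      h = H.map fun t => w * indexedRoot p q t := by
  obtain ⟨w, hw⟩ := Multiset.exists_mem_of_ne_zero hs.1
  have hw0 := (hs.2 w hw).ne_zero
  have hex : ∀ a ∈ h, ∃ t, w * indexedRoot p q t = a := fun a ha => by
    obtain ⟨t, ht⟩ := exists_indexedRoot_eq hpq hp hq (div_pow_eq_one_of_relOrder_dvd hs hdvd ha hw)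
    exact ⟨t, by rw [ht, mul_div_cancel₀ _ hw0]⟩
  choose! g hg using hex
  refine ⟨w, h.map g, hs.2 w hw, by simpa using hs.1, ?_⟩
  rw [Multiset.map_map, Function.comp_def, Multiset.map_congr rfl hg, Multiset.map_id']

theorem IsMinVanishing.eq_val_of_subset {α : Type*} {H : Multiset α} {f : α → ℂ}
    (hmv : IsMinVanishing (H.map f)) {S : Finset α} (hS : S.Nonempty) (hSH : ∀ t ∈ S, t ∈ H)
    (h0 : ∑ t ∈ S, f t = 0) : H = S.val := by
  have hle : S.val ≤ H := (Multiset.le_iff_subset S.nodup).mpr fun t ht => hSH t ht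
  have heq : S.val.map f = H.map f := by
    by_contra hne
    exact hmv.2 _ (Multiset.map_le_map hle) (by simpa using hS.ne_empty) hne h0
  have hcard := congrArg Multiset.card heq
  rw [Multiset.card_map, Multiset.card_map] at hcard
  exact (Multiset.eq_of_le_of_card_le hle hcard.ge).symm

theorem stmt_7 (p q : ℕ) (hp : p.Prime) (hq : q.Prime) (hpq : p < q)
    (hpodd : Odd p) (hqodd : Odd q)
    (h : Multiset ℂ) (hs : IsSorou h) (hmv : IsMinVanishing h)
    (hdvd : relOrder h ∣ 2 * p * q) :
    (∃ z : ℂ, IsRootOfUnity z ∧ h = {z, -z}) ∨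
    (∃ z : ℂ, IsRootOfUnity z ∧ h = (Multiset.range p).map (fun j => z * nu p ^ j)) ∨
    (∃ z : ℂ, IsRootOfUnity z ∧ h = (Multiset.range q).map (fun j => z * nu q ^ j)) ∨
    (∃ I : Finset ℕ, I ⊆ Finset.range p ∧ 0 ∈ I ∧ I ≠ Finset.range p ∧
        I.card ≤ (p - 1) / 2 ∧
      ∃ J : Finset ℕ, J ⊆ Finset.range q ∧ J.Nonempty ∧ J ≠ Finset.range q ∧
      ∃ z : ℂ, IsRootOfUnity z ∧
        h.map (fun w => z * w) =
          ((Finset.range q \ J).val.bind fun j => I.val.map fun i => nu p ^ i * nu q ^ j) +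
          (J.val.bind fun j => (Finset.range p \ I).val.map fun i => -(nu p ^ i * nu q ^ j))) := by
  have : Fact p.Prime := ⟨hp⟩
  have : Fact q.Prime := ⟨hq⟩
  obtain ⟨w, H, hw, hH, rfl⟩ := exists_indexed_of_relOrder_dvd hpq.ne hpodd hqodd hs hdvd
  have hline : ∀ (n : ℕ) [NeZero n] (z : ℂ), (Finset.univ : Finset (ZMod n)).val.map
      (fun i => z * ZMod.stdAddChar i) = (Multiset.range n).map fun j => z * nu n ^ j := by
    intro n _ z
    rw [← map_val_univ_zmod, Multiset.map_map]
    simp only [stdAddChar_eq_nu_pow, Function.comp_def]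
  rcases indexed_classification hpq.ne H hH
    (by simpa [Multiset.sum_map_mul_left, hw.ne_zero] using hmv.1)
    (fun S hS hSH h0 => hmv.eq_val_of_subset hS hSH (by rw [← Finset.mul_sum, h0, mul_zero]))
    with ⟨x, rfl⟩ | ⟨j, rfl⟩ | ⟨j, rfl⟩ | ⟨i, rfl⟩ | ⟨i, rfl⟩ | ⟨I, J, hI, hI', hJ, hJ', rfl⟩
  · refine Or.inl ⟨w * indexedRoot p q (.inl x),
      hw.mul ((isRootOfUnity_stdAddChar _).mul (isRootOfUnity_stdAddChar _)), ?_⟩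
    simp [indexedRoot]
  · refine Or.inr (Or.inl ⟨w * ZMod.stdAddChar j, hw.mul (isRootOfUnity_stdAddChar _), ?_⟩)
    rw [← hline, Multiset.map_map]
    refine Multiset.map_congr rfl fun i _ => ?_
    simp only [Function.comp_apply, indexedRoot, Sum.elim_inl]
    ring
  · refine Or.inr (Or.inl ⟨-(w * ZMod.stdAddChar j),
      (hw.mul (isRootOfUnity_stdAddChar _)).neg, ?_⟩)
    rw [← hline, Multiset.map_map]
    refine Multiset.map_congr rfl fun i _ => ?_
    simp only [Function.comp_apply, indexedRoot, Sum.elim_inr]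
    ring
  · refine Or.inr (Or.inr (Or.inl ⟨w * ZMod.stdAddChar i,
      hw.mul (isRootOfUnity_stdAddChar _), ?_⟩))
    rw [← hline, Multiset.map_map]
    refine Multiset.map_congr rfl fun j _ => ?_
    simp only [Function.comp_apply, indexedRoot, Sum.elim_inl]
    ring
  · refine Or.inr (Or.inr (Or.inl ⟨-(w * ZMod.stdAddChar i),
      (hw.mul (isRootOfUnity_stdAddChar _)).neg, ?_⟩))
    rw [← hline, Multiset.map_map]
    refine Multiset.map_congr rfl fun j _ => ?_
    simp only [Function.comp_apply, indexedRoot, Sum.elim_inr]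
    ring
  · obtain ⟨z, I', J', hz, h0, h1, h2, h3, h4, h5⟩ :=
      exists_normalized_signPattern hpodd hI hI' hJ hJ'
    refine Or.inr (Or.inr (Or.inr ⟨I'.image ZMod.val, image_val_subset_range I',
      Finset.mem_image.mpr ⟨0, h0, ZMod.val_zero⟩, image_val_ne_range h1,
      Finset.card_image_le.trans h2, J'.image ZMod.val, image_val_subset_range J', h3.image _,
      image_val_ne_range h4, z * w⁻¹, hz.mul hw.inv, ?_⟩))
    rw [← map_signPattern, ← h5, Multiset.map_map]
    refine Multiset.map_congr rfl fun t _ => ?_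
    rw [Function.comp_apply, mul_assoc, inv_mul_cancel_left₀ hw.ne_zero]
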